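/- Let K ⊆ ℝ² be a q-compact convex body. Then β = v if and only if α = u. -/

import Mathlib

open Set Pointwise

/-- The topology on `X` induced by the asymmetric "norm" `q`:
`U` is open iff around each of its points it contains a forward ball `{y | q (y - x) < ε}`. -/
def ballTop {X : Type*} [Sub X] (q : X → ℝ) : TopologicalSpace X where
  IsOpen U := ∀ x ∈ U, ∃ ε > 0, ∀ y, q (y - x) < ε → y ∈ U
  isOpen_univ := fun _ _ => ⟨1, one_pos, fun _ _ => trivial⟩
  isOpen_inter := fun U V hU hV x hx => by
    obtain ⟨ε₁, hε₁, h₁⟩ := hU x hx.1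
    obtain ⟨ε₂, hε₂, h₂⟩ := hV x hx.2
    exact ⟨min ε₁ ε₂, lt_min hε₁ hε₂, fun y hy =>
      ⟨h₁ y (hy.trans_le (min_le_left _ _)), h₂ y (hy.trans_le (min_le_right _ _))⟩⟩
  isOpen_sUnion := fun S hS x hx => by
    obtain ⟨U, hUS, hxU⟩ := hx
    obtain ⟨ε, hε, h⟩ := hS U hUS x hxU
    exact ⟨ε, hε, fun y hy => ⟨U, hUS, h y hy⟩⟩

/-- The asymmetric lattice norm on `ℝ²` induced by a lattice norm `N`: `q x = N (x ∨ 0)`. -/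
def q2 (N : ℝ × ℝ → ℝ) : ℝ × ℝ → ℝ := fun x => N (max x.1 0, max x.2 0)

/-- `θ₀ = {x | q x = 0}`. -/
def theta0 (N : ℝ × ℝ → ℝ) : Set (ℝ × ℝ) := {x | q2 N x = 0}

/-- Translate of a set of `ℝ²` by a vector. -/
def transl (a : ℝ × ℝ) (S : Set (ℝ × ℝ)) : Set (ℝ × ℝ) := (a + ·) '' S

/-- The interior of `θ₀` with respect to the `q`-topology. -/
def thetaIntQ (N : ℝ × ℝ → ℝ) : Set (ℝ × ℝ) :=
  @interior _ (ballTop (q2 N)) (theta0 N)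

/-- On a nonempty compact set, two upper semicontinuous functions have a lexicographic maximum. -/
theorem exists_lex_max {X : Type*} [TopologicalSpace X] {K : Set X} (hK : IsCompact K)
    (hne : K.Nonempty) {f g : X → ℝ} (hf : UpperSemicontinuous f) (hg : UpperSemicontinuous g) :
    ∃ p ∈ K, (∀ x ∈ K, f x ≤ f p) ∧ ∀ x ∈ K, f x = f p → g x ≤ g p := by
  obtain ⟨m, hmK, hm⟩ := (hf.upperSemicontinuousOn K).exists_isMaxOn hne hK
  have hm' : m ∈ K ∩ f ⁻¹' Ici (f m) := ⟨hmK, le_refl (f m)⟩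
  obtain ⟨p, ⟨hpK, hp⟩, hpmax⟩ := (hg.upperSemicontinuousOn _).exists_isMaxOn
    ⟨m, hm'⟩ (hK.inter_right (hf.isClosed_preimage (f m)))
  exact ⟨p, hpK, fun x hx => (hm hx).trans hp, fun x hx h => hpmax ⟨hx, hp.trans h.ge⟩⟩

/-- A function `f` whose increments are controlled from above by `q` is upper semicontinuous for
the topology induced by `q`. -/
theorem upperSemicontinuous_ballTop {X : Type*} [Sub X] {q : X → ℝ} {f : X → ℝ} {c : ℝ}
    (hc : 0 < c) (h : ∀ x y, c * (f y - f x) ≤ q (y - x)) :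
    @UpperSemicontinuous X ℝ (ballTop q) _ f := by
  let _ := ballTop q
  rw [upperSemicontinuous_iff_isOpen_preimage]
  intro r x hx
  refine ⟨c * (r - f x), mul_pos hc (sub_pos.2 hx), fun y hy => ?_⟩
  have := lt_of_mul_lt_mul_left ((h x y).trans_lt hy) hc.le
  exact sub_lt_sub_iff_right _ |>.1 this

/-- The coordinates of `x` are bounded above by multiples of `q x`. -/
theorem mul_le_q2 {N : ℝ × ℝ → ℝ} (hNs : ∀ (c : ℝ) (x : ℝ × ℝ), N (c • x) = |c| * N x)
    (hNl : ∀ x y : ℝ × ℝ, |x.1| ≤ |y.1| → |x.2| ≤ |y.2| → N x ≤ N y)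
    (x : ℝ × ℝ) :
    N (1, 0) * x.1 ≤ q2 N x ∧ N (0, 1) * x.2 ≤ q2 N x := by
  have hN : ∀ y, 0 ≤ N y := fun y => by
    have h0 : N 0 = 0 := by simpa using hNs 0 0
    exact h0 ▸ hNl 0 y (by simp) (by simp)
  constructor
  · calc N (1, 0) * x.1 ≤ N (1, 0) * max x.1 0 :=
          mul_le_mul_of_nonneg_left (le_max_left _ _) (hN _)
      _ = N (max x.1 0 • (1, 0)) := by rw [hNs, abs_of_nonneg (le_max_right _ _), mul_comm]
      _ ≤ q2 N x := hNl _ _ (by simp) (by simp)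
  · calc N (0, 1) * x.2 ≤ N (0, 1) * max x.2 0 :=
          mul_le_mul_of_nonneg_left (le_max_left _ _) (hN _)
      _ = N (max x.2 0 • (0, 1)) := by rw [hNs, abs_of_nonneg (le_max_right _ _), mul_comm]
      _ ≤ q2 N x := hNl _ _ (by simp) (by simp)

/-- For a `q`-compact convex body `K ⊆ ℝ²`, `β = v` iff `α = u`. -/
theorem beta_eq_v_iff_alpha_eq_u
    (N : ℝ × ℝ → ℝ)
    (hN0 : ∀ x : ℝ × ℝ, N x = 0 ↔ x = 0)
    (hNs : ∀ (c : ℝ) (x : ℝ × ℝ), N (c • x) = |c| * N x)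
    (hNt : ∀ x y : ℝ × ℝ, N (x + y) ≤ N x + N y)
    (hNl : ∀ x y : ℝ × ℝ, |x.1| ≤ |y.1| → |x.2| ≤ |y.2| → N x ≤ N y)
    (K : Set (ℝ × ℝ)) (hconv : Convex ℝ K)
    (hcomp : @IsCompact _ (ballTop (q2 N)) K)
    (hbody : (@interior _ (ballTop (q2 N)) K).Nonempty)
    (u v a b : ℝ)
    (hu : u = sSup (Prod.fst '' K)) (hv : v = sSup (Prod.snd '' K))
    (ha : a = sSup {x : ℝ | (x, v) ∈ K}) (hb : b = sSup {y : ℝ | (u, y) ∈ K}) :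
    b = v ↔ a = u := by
  have hpos : ∀ x, x ≠ 0 → 0 < N x := fun x hx => by
    refine lt_of_le_of_ne ?_ fun h => hx ((hN0 x).1 h.symm)
    exact (hN0 0).2 rfl ▸ hNl 0 x (by simp) (by simp)
  have hfst : @UpperSemicontinuous _ ℝ (ballTop (q2 N)) _ Prod.fst :=
    upperSemicontinuous_ballTop (hpos (1, 0) (by simp)) fun x y => (mul_le_q2 hNs hNl (y - x)).1
  have hsnd : @UpperSemicontinuous _ ℝ (ballTop (q2 N)) _ Prod.snd :=
    upperSemicontinuous_ballTop (hpos (0, 1) (by simp)) fun x y => (mul_le_q2 hNs hNl (y - x)).2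
  have hne : K.Nonempty := hbody.mono (@interior_subset _ (ballTop (q2 N)) K)
  obtain ⟨⟨p₁, p₂⟩, hpK, hp, hp'⟩ := @exists_lex_max _ (ballTop (q2 N)) _ hcomp hne _ _ hfst hsnd
  obtain ⟨⟨r₁, r₂⟩, hrK, hr, hr'⟩ := @exists_lex_max _ (ballTop (q2 N)) _ hcomp hne _ _ hsnd hfst
  obtain rfl : u = p₁ := hu.trans (IsGreatest.csSup_eq ⟨⟨_, hpK, rfl⟩, forall_mem_image.2 hp⟩)
  obtain rfl : v = r₂ := hv.trans (IsGreatest.csSup_eq ⟨⟨_, hrK, rfl⟩, forall_mem_image.2 hr⟩)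
  obtain rfl : b = p₂ := hb.trans (IsGreatest.csSup_eq ⟨hpK, fun y hy => hp' _ hy rfl⟩)
  obtain rfl : a = r₁ := ha.trans (IsGreatest.csSup_eq ⟨hrK, fun x hx => hr' _ hx rfl⟩)
  constructor
  · rintro rfl
    exact le_antisymm (hp _ hrK) (hr' _ hpK rfl)
  · rintro rfl
    exact le_antisymm (hr _ hpK) (hp' _ hrK rfl)
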